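/- Let f ∈ S₁(ℝⁿ). Then dom(Pf) = ℝⁿ, Pf vanishes only at the origin, and f is polar differentiable at every point x ≠ 0 (i.e., ∂°f(x) is a singleton for all x ≠ 0). -/

import Mathlib

open scoped ENNReal RealInnerProductSpace
open Set

noncomputable section

/-- Euclidean space `ℝⁿ`. -/
abbrev Euc (n : ℕ) := EuclideanSpace ℝ (Fin n)

/-- The polarity transform `𝒫`:
`(Pf)(y) = inf {c ≥ 0 : ⟨x,y⟩ ≤ 1 + c·f(x) for all x}`, with `inf ∅ = ∞`.
(Nonnegativity of `c` is automatic since we work in `ℝ≥0∞`.) -/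
def polarT {n : ℕ} (f : Euc n → ℝ≥0∞) (y : Euc n) : ℝ≥0∞ :=
  sInf {c : ℝ≥0∞ | ∀ x : Euc n, ENNReal.ofReal ⟪x, y⟫ ≤ 1 + c * f x}

/-- The class `Cvx₀(ℝⁿ)` of geometric convex functions: lower semicontinuous, convex,
nonnegative (automatic), vanishing at the origin. -/
def GeomConvexOn {n : ℕ} (f : Euc n → ℝ≥0∞) : Prop :=
  (∀ x y : Euc n, ∀ a b : ℝ, 0 ≤ a → 0 ≤ b → a + b = 1 →
    f (a • x + b • y) ≤ ENNReal.ofReal a * f x + ENNReal.ofReal b * f y) ∧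
  LowerSemicontinuous f ∧ f 0 = 0

/-- The polar set `K° = {y : ⟨x,y⟩ ≤ 1 ∀ x ∈ K}`. -/
def polarSet {n : ℕ} (K : Set (Euc n)) : Set (Euc n) :=
  {y : Euc n | ∀ x ∈ K, ⟪x, y⟫ ≤ 1}

/-- The Legendre transform `(Lf)(y) = sup_x (⟨x,y⟩ - f(x))` of a `[0,∞]`-valued function,
with values in `[0,∞]` (for `f` with `f(0) = 0` the supremum is automatically `≥ 0`,
so the `ℝ≥0∞`-valued truncated subtraction computes the genuine Legendre transform). -/
def legendreT {n : ℕ} (f : Euc n → ℝ≥0∞) (y : Euc n) : ℝ≥0∞ :=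
  ⨆ x : Euc n, ENNReal.ofReal ⟪x, y⟫ - f x

/-- The usual subdifferential `∂g(x) = {y : g(z) ≥ g(x) + ⟨z - x, y⟩ ∀ z}`,
stated in `EReal` to accommodate `[0,∞]`-valued functions. -/
def subdiff {n : ℕ} (g : Euc n → ℝ≥0∞) (x : Euc n) : Set (Euc n) :=
  {y : Euc n | ∀ z : Euc n, (g x : EReal) + ((⟪z - x, y⟫ : ℝ) : EReal) ≤ (g z : EReal)}

/-- The polar subdifferential `∂°f(x) = {y ∈ dom(Pf) : Pf(y)·f(x) = ⟨x,y⟩ - 1}`. -/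
def polarSubdiff {n : ℕ} (f : Euc n → ℝ≥0∞) (x : Euc n) : Set (Euc n) :=
  {y : Euc n | polarT f y ≠ ∞ ∧
    (polarT f y : EReal) * (f x : EReal) = ((⟪x, y⟫ - 1 : ℝ) : EReal)}

/-- `g` restricted to the segment `[0,x]` is linear (i.e. `g(t•x) = c·t` for `t ∈ [0,1]`). -/
def RayLinear {n : ℕ} (g : Euc n → ℝ≥0∞) (x : Euc n) : Prop :=
  ∃ c : ℝ, 0 ≤ c ∧ ∀ t : ℝ, t ∈ Icc (0:ℝ) 1 → g (t • x) = ENNReal.ofReal (c * t)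

/-- `g` is not linear on `[0,x+]`: there is no `t > 1` such that `g` is linear on `[0,t•x]`. -/
def NotLinearPlus {n : ℕ} (g : Euc n → ℝ≥0∞) (x : Euc n) : Prop :=
  ¬ ∃ t : ℝ, 1 < t ∧ RayLinear g (t • x)

/-- `f` is nonlinear at infinity: for every ray `ℝ⁺x`, `t ↦ f(tx)` is finite everywhere and
is not squeezed between `at - b` and `at` for any `a ≥ 0`, `b > 0`. -/
def NonlinearAtInfinity {n : ℕ} (f : Euc n → ℝ≥0∞) : Prop :=
  ∀ x : Euc n, x ≠ 0 →
    (∀ t : ℝ, 0 ≤ t → f (t • x) ≠ ∞) ∧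
    ¬ ∃ a b : ℝ, 0 ≤ a ∧ 0 < b ∧ ∀ t : ℝ, 0 ≤ t →
        ENNReal.ofReal (a * t - b) ≤ f (t • x) ∧ f (t • x) ≤ ENNReal.ofReal (a * t)

/-- The class `S₁(ℝⁿ)`: geometric convex functions which are finite-valued, continuously
differentiable off the origin, and strictly convex. -/
def S1 {n : ℕ} (f : Euc n → ℝ≥0∞) : Prop :=
  GeomConvexOn f ∧ (∀ x, f x ≠ ∞) ∧
  ContDiffOn ℝ 1 (fun x => (f x).toReal) ({0}ᶜ : Set (Euc n)) ∧
  StrictConvexOn ℝ (univ : Set (Euc n)) (fun x => (f x).toReal)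

/-- The Hessian of a real-valued function, as the derivative of the gradient map. -/
def hess {n : ℕ} (g : Euc n → ℝ) (x : Euc n) : Euc n →L[ℝ] Euc n :=
  fderiv ℝ (fun z => gradient g z) x

/-- The class `S₂(ℝⁿ)`: geometric convex functions which are finite-valued, strictly convex,
twice continuously differentiable off the origin with positive definite Hessian there. -/
def S2 {n : ℕ} (f : Euc n → ℝ≥0∞) : Prop :=
  GeomConvexOn f ∧ (∀ x, f x ≠ ∞) ∧
  StrictConvexOn ℝ (univ : Set (Euc n)) (fun x => (f x).toReal) ∧
  ContDiffOn ℝ 2 (fun x => (f x).toReal) ({0}ᶜ : Set (Euc n)) ∧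
  ∀ x : Euc n, x ≠ 0 → ∀ v : Euc n, v ≠ 0 →
    0 < ⟪v, hess (fun z => (f z).toReal) x v⟫

/-- The gradient inequality for a convex function on a real Hilbert space. -/
lemma ConvexOn.add_inner_le_of_hasGradientAt {E : Type*} [NormedAddCommGroup E]
    [InnerProductSpace ℝ E] [CompleteSpace E] {g : E → ℝ} (hg : ConvexOn ℝ univ g) {x v : E}
    (hv : HasGradientAt g v x) (z : E) : g x + ⟪z - x, v⟫ ≤ g z := by
  have hline : HasDerivAt (g ∘ AffineMap.lineMap (k := ℝ) x z) ⟪z - x, v⟫ 0 := by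
    have h0 : HasFDerivAt g (InnerProductSpace.toDual ℝ E v) (AffineMap.lineMap x z (0 : ℝ)) := by
      simpa using hv.hasFDerivAt
    have := h0.comp_hasDerivAt (0 : ℝ) AffineMap.hasDerivAt_lineMap
    simpa [real_inner_comm] using this
  have hconv : ConvexOn ℝ univ (g ∘ AffineMap.lineMap (k := ℝ) x z) := by
    simpa using hg.comp_affineMap (AffineMap.lineMap (k := ℝ) x z)
  have := hconv.le_slope_of_hasDerivAt (mem_univ 0) (mem_univ 1) zero_lt_one hline
  simp [slope_def_field] at this
  linarith

/-- A strictly convex function with minimum value `0` at the origin satisfies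
`g x < ⟨x, ∇g(x)⟩` for `x ≠ 0`. -/
lemma StrictConvexOn.lt_inner_of_hasGradientAt {E : Type*} [NormedAddCommGroup E]
    [InnerProductSpace ℝ E] [CompleteSpace E] {g : E → ℝ} (hg : StrictConvexOn ℝ univ g)
    (hg0 : g 0 = 0) {x v : E} (hx : x ≠ 0) (hv : HasGradientAt g v x) : g x < ⟪x, v⟫ := by
  have h1 := hg.convexOn.add_inner_le_of_hasGradientAt hv ((1 / 2 : ℝ) • x)
  have h2 := hg.2 (mem_univ x) (mem_univ 0) hx (one_half_pos (α := ℝ)) one_half_pos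
    (add_halves 1)
  rw [inner_sub_left, real_inner_smul_left] at h1
  simp only [smul_zero, add_zero, hg0, smul_eq_mul] at h2
  linarith

/-- A nonnegative strictly convex function vanishing at the origin is positive elsewhere. -/
lemma StrictConvexOn.pos_of_ne_zero {E : Type*} [AddCommGroup E] [Module ℝ E] {g : E → ℝ}
    (hg : StrictConvexOn ℝ univ g) (hg0 : g 0 = 0) (hnonneg : ∀ x, 0 ≤ g x) {x : E}
    (hx : x ≠ 0) : 0 < g x := by
  have h2 := hg.2 (mem_univ x) (mem_univ 0) hx (one_half_pos (α := ℝ)) one_half_pos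
    (add_halves 1)
  have := hnonneg ((1 / 2 : ℝ) • x + (1 / 2 : ℝ) • (0 : E))
  rw [hg0] at h2
  simp only [smul_eq_mul] at h2
  linarith

/-- A convex function which vanishes at the origin and is positive elsewhere grows at least
linearly outside any ball. -/
lemma ConvexOn.exists_linear_growth {E : Type*} [NormedAddCommGroup E] [NormedSpace ℝ E]
    [FiniteDimensional ℝ E] {g : E → ℝ} (hg : ConvexOn ℝ univ g) (hg0 : g 0 = 0)
    (hpos : ∀ x, x ≠ 0 → 0 < g x) {r : ℝ} (hr : 0 < r) :
    ∃ m, 0 < m ∧ ∀ x, r ≤ ‖x‖ → m * ‖x‖ ≤ g x := by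
  have : ProperSpace E := FiniteDimensional.proper ℝ E
  obtain ⟨m, hm, hmin⟩ := (isCompact_sphere (0 : E) r).exists_forall_le'
    ((hg.continuousOn isOpen_univ).mono (subset_univ _)) (a := 0) fun x hx =>
      hpos x (ne_zero_of_mem_sphere hr.ne' ⟨x, hx⟩)
  refine ⟨m / r, div_pos hm hr, fun x hx => ?_⟩
  have hx0 : 0 < ‖x‖ := hr.trans_le hx
  have hmem : (r / ‖x‖) • x ∈ Metric.sphere (0 : E) r := by
    simp [norm_smul, abs_of_pos hr, hx0.ne']
  have h1 := hmin _ hmem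
  have h2 := hg.2 (mem_univ x) (mem_univ 0) (show 0 ≤ r / ‖x‖ by positivity)
    (show 0 ≤ 1 - r / ‖x‖ from sub_nonneg.mpr ((div_le_one hx0).mpr hx)) (by ring)
  simp only [smul_zero, add_zero, hg0, smul_eq_mul, mul_zero] at h2
  have h3 : m ≤ r / ‖x‖ * g x := h1.trans h2
  calc m / r * ‖x‖ ≤ (r / ‖x‖ * g x) / r * ‖x‖ := by gcongr
    _ = g x := by field_simp

lemma polarT_le_ofReal {n : ℕ} {f : Euc n → ℝ≥0∞} (hfin : ∀ x, f x ≠ ∞) {y : Euc n} {c : ℝ}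
    (hc : 0 ≤ c) (h : ∀ x, ⟪x, y⟫ ≤ 1 + c * (f x).toReal) : polarT f y ≤ ENNReal.ofReal c := by
  refine sInf_le fun x => ?_
  rw [← ENNReal.ofReal_toReal (hfin x), ← ENNReal.ofReal_mul hc, ← ENNReal.ofReal_one,
    ← ENNReal.ofReal_add zero_le_one (by positivity)]
  exact ENNReal.ofReal_le_ofReal (h x)

/-- The infimum defining the polarity transform is attained where it is finite. -/
lemma inner_le_one_add_polarT_mul {n : ℕ} {f : Euc n → ℝ≥0∞} (hfin : ∀ x, f x ≠ ∞) {y : Euc n}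
    (hy : polarT f y ≠ ∞) (x : Euc n) : ⟪x, y⟫ ≤ 1 + (polarT f y).toReal * (f x).toReal := by
  have hclosed : IsClosed {c : ℝ≥0∞ | ∀ x : Euc n, ENNReal.ofReal ⟪x, y⟫ ≤ 1 + c * f x} := by
    rw [ofPred_forall]
    exact isClosed_iInter fun x => isClosed_le continuous_const
      (continuous_const.add (ENNReal.continuous_mul_const (hfin x)))
  have hne : {c : ℝ≥0∞ | ∀ x : Euc n, ENNReal.ofReal ⟪x, y⟫ ≤ 1 + c * f x}.Nonempty := by
    by_contra hempty
    exact hy (by rw [polarT, not_nonempty_iff_eq_empty.mp hempty, sInf_empty])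
  have hmem : ENNReal.ofReal ⟪x, y⟫ ≤ 1 + polarT f y * f x := hclosed.sInf_mem hne x
  rw [← ENNReal.ofReal_toReal hy, ← ENNReal.ofReal_toReal (hfin x),
    ← ENNReal.ofReal_mul ENNReal.toReal_nonneg, ← ENNReal.ofReal_one,
    ← ENNReal.ofReal_add zero_le_one (by positivity)] at hmem
  exact (ENNReal.ofReal_le_ofReal_iff (by positivity)).mp hmem

lemma mem_polarSubdiff_iff {n : ℕ} {f : Euc n → ℝ≥0∞} {x y : Euc n} (hx : f x ≠ ∞) :
    y ∈ polarSubdiff f x ↔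
      polarT f y ≠ ∞ ∧ (polarT f y).toReal * (f x).toReal = ⟪x, y⟫ - 1 := by
  refine and_congr_right fun hy => ?_
  rw [← EReal.coe_ennreal_mul, ← ENNReal.toReal_mul,
    ← EReal.coe_ennreal_toReal (ENNReal.mul_ne_top hy hx), EReal.coe_eq_coe_iff]

lemma polarT_ne_top {n : ℕ} {f : Euc n → ℝ≥0∞} (hfin : ∀ x, f x ≠ ∞) (hf0 : f 0 = 0)
    (hf : StrictConvexOn ℝ univ fun x => (f x).toReal) (y : Euc n) : polarT f y ≠ ∞ := by
  have hg0 : (f 0).toReal = 0 := by simp [hf0]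
  obtain ⟨m, hm, hgrowth⟩ := hf.convexOn.exists_linear_growth hg0
    (fun x => hf.pos_of_ne_zero hg0 fun _ => ENNReal.toReal_nonneg)
    (r := 1 / (‖y‖ + 1)) (by positivity)
  refine ne_top_of_le_ne_top ENNReal.ofReal_ne_top
    (polarT_le_ofReal hfin (c := ‖y‖ / m) (by positivity) fun x => ?_)
  have hxy := real_inner_le_norm x y
  have hnn : 0 ≤ ‖y‖ / m * (f x).toReal := by positivity
  rcases le_total (1 / (‖y‖ + 1)) ‖x‖ with h | h
  · have : ‖x‖ * ‖y‖ = ‖y‖ / m * (m * ‖x‖) := by field_simp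
    have := mul_le_mul_of_nonneg_left (hgrowth x h) (show 0 ≤ ‖y‖ / m by positivity)
    linarith
  · have : ‖x‖ * (‖y‖ + 1) ≤ 1 := (le_div_iff₀ (by positivity)).mp h
    nlinarith [norm_nonneg x]

lemma polarT_eq_zero_iff {n : ℕ} {f : Euc n → ℝ≥0∞} (hfin : ∀ x, f x ≠ ∞) {y : Euc n} :
    polarT f y = 0 ↔ y = 0 := by
  constructor
  · intro h
    by_contra hy
    have h1 := inner_le_one_add_polarT_mul hfin (y := y) (by simp [h]) ((2 / ‖y‖ ^ 2) • y)
    have : ‖y‖ ≠ 0 := norm_ne_zero_iff.mpr hy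
    rw [h, real_inner_smul_left, real_inner_self_eq_norm_sq, div_mul_cancel₀ _ (by positivity)] at h1
    norm_num at h1
  · rintro rfl
    simpa using polarT_le_ofReal hfin (y := 0) le_rfl (by simp)

/-- At a point where the gradient `v` of `f` exists, the polar subdifferential of a strictly
convex `f` is `{v / (⟨x, v⟩ - f(x))}`. -/
lemma polarSubdiff_eq_singleton {n : ℕ} {f : Euc n → ℝ≥0∞} (hfin : ∀ x, f x ≠ ∞) (hf0 : f 0 = 0)
    (hf : StrictConvexOn ℝ univ fun x => (f x).toReal) {x v : Euc n} (hx : x ≠ 0)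
    (hv : HasGradientAt (fun x => (f x).toReal) v x) :
    polarSubdiff f x = {(⟪x, v⟫ - (f x).toReal)⁻¹ • v} := by
  have hg0 : (f 0).toReal = 0 := by simp [hf0]
  have hpos : 0 < (f x).toReal := hf.pos_of_ne_zero hg0 (fun _ => ENNReal.toReal_nonneg) hx
  have hD : 0 < ⟪x, v⟫ - (f x).toReal := sub_pos.mpr (hf.lt_inner_of_hasGradientAt hg0 hx hv)
  set D := ⟪x, v⟫ - (f x).toReal with hDdef
  have hxv : ⟪x, v⟫ = D + (f x).toReal := by rw [hDdef]; ring
  ext y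
  rw [mem_polarSubdiff_iff (hfin x), mem_singleton_iff]
  constructor
  · rintro ⟨hy, heq⟩
    set p := (polarT f y).toReal
    have hmin : IsLocalMin (fun z => p * (f z).toReal - ⟪y, z⟫) x := by
      refine Filter.Eventually.of_forall fun z => ?_
      have := inner_le_one_add_polarT_mul hfin hy z
      rw [real_inner_comm] at this heq
      dsimp only
      linarith
    have hderiv := (hv.hasFDerivAt.const_mul p).sub (innerSL ℝ y).hasFDerivAt
    have hzero := hmin.hasFDerivAt_eq_zero hderiv
    have hyv : y = p • v := by
      refine ext_inner_right ℝ fun w => ?_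
      have := congrArg (fun L : Euc n →L[ℝ] ℝ => L w) hzero
      simp at this
      rw [real_inner_smul_left]
      linarith
    have hpD : p * D = 1 := by
      rw [hyv, real_inner_smul_right, hxv] at heq
      linarith
    rw [hyv, eq_inv_of_mul_eq_one_left hpD]
  · rintro rfl
    have hle : polarT f (D⁻¹ • v) ≤ ENNReal.ofReal D⁻¹ := by
      refine polarT_le_ofReal hfin (by positivity) fun z => ?_
      have := hf.convexOn.add_inner_le_of_hasGradientAt hv z
      rw [inner_sub_left, hxv] at this
      rw [real_inner_smul_right]
      have h2 : D⁻¹ * ⟪z, v⟫ ≤ D⁻¹ * (D + (f z).toReal) := by gcongr; linarith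
      rwa [mul_add, inv_mul_cancel₀ hD.ne'] at h2
    have hne : polarT f (D⁻¹ • v) ≠ ∞ := ne_top_of_le_ne_top ENNReal.ofReal_ne_top hle
    refine ⟨hne, le_antisymm ?_ ?_⟩
    · have h1 := ENNReal.toReal_mono ENNReal.ofReal_ne_top hle
      rw [ENNReal.toReal_ofReal (by positivity)] at h1
      rw [real_inner_smul_right, hxv, mul_add, inv_mul_cancel₀ hD.ne', add_sub_cancel_left]
      gcongr
    · linarith [inner_le_one_add_polarT_mul hfin hne x]

/-- Proposition 3.6 (1)-(2): for `f ∈ S₁(ℝⁿ)`, `dom(Pf) = ℝⁿ`, `Pf` vanishes only at the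
origin, and `f` is polar differentiable at every `x ≠ 0`. -/
theorem stmt_9 {n : ℕ} (f : Euc n → ℝ≥0∞) (hf : S1 f) :
    {y : Euc n | polarT f y ≠ ∞} = univ ∧
    {y : Euc n | polarT f y = 0} = {0} ∧
    ∀ x : Euc n, x ≠ 0 → ∃ y : Euc n, polarSubdiff f x = {y} := by
  obtain ⟨⟨-, -, hf0⟩, hfin, hdiff, hconv⟩ := hf
  refine ⟨eq_univ_of_forall (polarT_ne_top hfin hf0 hconv),
    ext fun y => polarT_eq_zero_iff hfin, fun x hx => ?_⟩
  have hx' : DifferentiableAt ℝ (fun x => (f x).toReal) x :=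
    (hdiff.contDiffAt (isOpen_compl_singleton.mem_nhds hx)).differentiableAt one_ne_zero
  exact ⟨_, polarSubdiff_eq_singleton hfin hf0 hconv hx hx'.hasGradientAt⟩
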